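/- Let 1 ≤ u ≤ k−1. The torsion code Tor(M^α_(q,k,u)) of the MacDonald code of type α is a binary linear code of length 2^(2^q·k) − 2^(2^q·u) with exactly 2^k codewords, whose Hamming weight distribution is: one codeword of weight 0; exactly 2^k − 2^(k−u) codewords of weight 2^(2^q·k − 1) − 2^(2^q·u − 1); and exactly 2^(k−u) − 1 codewords of weight 2^(2^q·k − 1). In particular its minimum Hamming distance is 2^(2^q·k − 1) − 2^(2^q·u − 1). -/

import Mathlib

/-- The ideal of `F₂[u₁,…,u_q]` generated by the squares of all the variables. -/
noncomputable def sqIdeal (q : ℕ) : Ideal (MvPolynomial (Fin q) (ZMod 2)) :=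
  Ideal.span (Set.range fun i : Fin q => MvPolynomial.X i ^ 2)

/-- The ring `R_q = F₂[u₁,…,u_q]/⟨u₁²,…,u_q²⟩`. -/
abbrev Rq (q : ℕ) := MvPolynomial (Fin q) (ZMod 2) ⧸ sqIdeal q

/-- The monomial `u_A = ∏_{i ∈ A} u_i ∈ R_q`. -/
noncomputable def uA (q : ℕ) (A : Finset (Fin q)) : Rq q :=
  ∏ i ∈ A, Ideal.Quotient.mk (sqIdeal q) (MvPolynomial.X i)

/-- The top monomial `u₁u₂⋯u_q ∈ R_q`. -/
noncomputable def uTop (q : ℕ) : Rq q := uA q Finset.univ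

set_option synthInstance.maxHeartbeats 1000000
set_option maxHeartbeats 1000000

/-- The coordinate index set of the MacDonald code `M^α_(q,k,u)`: those `v ∈ R_q^k` whose first
`k − u` entries are not all zero. -/
def MacIdx (q k u : ℕ) : Type :=
  {v : Fin k → Rq q // ∃ i : Fin k, (i : ℕ) < k - u ∧ v i ≠ 0}

/-- The torsion code of the MacDonald code `M^α_(q,k,u)` of type α: binary words `c` such that
`(u₁⋯u_q)·ι(c)` is a codeword of `M^α_(q,k,u)`, with `ι : F₂ → R_q` the inclusion. -/
noncomputable def macTorsion (q k u : ℕ) : Set (MacIdx q k u → ZMod 2) :=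
  {c | ∃ m : Fin k → Rq q, ∀ v : MacIdx q k u,
    uTop q * algebraMap (ZMod 2) (Rq q) (c v) = ∑ i, m i * v.1 i}

/-- The Hamming weight of a binary word (number of nonzero coordinates). -/
noncomputable def hWt {ι : Type} (c : ι → ZMod 2) : ℕ := Nat.card {v : ι // c v ≠ 0}

open scoped Classical in
lemma card_supported {ι M : Type} [Finite ι] [Zero M] (P : ι → Prop) :
    Nat.card {g : ι → M // ∀ i, ¬ P i → g i = 0} = Nat.card M ^ Nat.card {i // P i} := by
  rw [← Nat.card_fun]
  refine Nat.card_congr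
    { toFun := fun g i => g.1 i.1
      invFun := fun h => ⟨fun i => if hi : P i then h ⟨i, hi⟩ else 0, fun i hi => by simp [hi]⟩
      left_inv := ?_
      right_inv := ?_ }
  · rintro ⟨g, hg⟩
    ext i
    by_cases hi : P i
    · simp [hi]
    · simp [hi, hg i hi]
  · intro h
    ext i
    simp [i.2]

lemma card_lt_sub (k u : ℕ) : Nat.card {i : Fin k // (i : ℕ) < k - u} = k - u := by
  rw [Nat.card_congr (show {i : Fin k // (i : ℕ) < k - u} ≃ Fin (k - u) from
    { toFun := fun i => ⟨i.1.1, i.2⟩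
      invFun := fun i => ⟨⟨i.1, by omega⟩, i.2⟩
      left_inv := fun i => rfl
      right_inv := fun i => rfl })]
  simp

lemma card_compl_add {α : Type} [Finite α] (P : α → Prop) :
    Nat.card {a // P a} + Nat.card {a // ¬ P a} = Nat.card α := by
  classical
  rw [← Nat.card_sum]
  exact Nat.card_congr (Equiv.sumCompl P)

lemma zmod2_cases (x : ZMod 2) : x = 0 ∨ x = 1 := by
  revert x; decide

lemma card_half {G : Type} [AddCommGroup G] [Finite G] (f : G →+ ZMod 2) (g : G) (hg : f g = 1) :
    2 * Nat.card {v // f v ≠ 0} = Nat.card G := by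
  rw [← card_compl_add (fun v => f v = 0), two_mul]
  congr 1
  refine Nat.card_congr ((Equiv.addRight g).subtypeEquiv ?_)
  intro v
  simp only [Equiv.coe_addRight, map_add, hg]
  rcases zmod2_cases (f v) with h | h <;> rw [h] <;> decide

lemma mem_sqIdeal (q : ℕ) (p : MvPolynomial (Fin q) (ZMod 2)) :
    p ∈ sqIdeal q ↔ ∀ m ∈ p.support, ∃ i, 2 ≤ m i := by
  have h : sqIdeal q = Ideal.span ((fun s => MvPolynomial.monomial s (1 : ZMod 2)) ''
      (Set.range fun i : Fin q => Finsupp.single i 2)) := by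
    rw [sqIdeal, ← Set.range_comp]
    congr 2
    ext1 i
    simp [MvPolynomial.X_pow_eq_monomial]
  rw [h, MvPolynomial.mem_ideal_span_monomial_image]
  simp

/-- indicator exponent -/
noncomputable def indE (q : ℕ) (A : Finset (Fin q)) : Fin q →₀ ℕ :=
  Finsupp.equivFunOnFinite.symm (fun i => if i ∈ A then 1 else 0)

lemma indE_apply (q : ℕ) (A : Finset (Fin q)) (i : Fin q) :
    indE q A i = if i ∈ A then 1 else 0 := rfl

lemma indE_inj (q : ℕ) : Function.Injective (indE q) := by
  intro A B h
  ext i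
  have := DFunLike.congr_fun h i
  simp only [indE_apply] at this
  split_ifs at this <;> simp_all

/-- coefficients at squarefree monomials -/
noncomputable def sqfCoeff (q : ℕ) :
    MvPolynomial (Fin q) (ZMod 2) →+ (Finset (Fin q) → ZMod 2) where
  toFun p A := p.coeff (indE q A)
  map_zero' := by ext; simp
  map_add' := by intros; ext; simp

lemma mem_iff_coeff (q : ℕ) (p : MvPolynomial (Fin q) (ZMod 2)) :
    p ∈ sqIdeal q ↔ sqfCoeff q p = 0 := by
  rw [mem_sqIdeal]
  constructor
  · intro h
    ext A
    by_contra hc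
    obtain ⟨i, hi⟩ := h (indE q A) (MvPolynomial.mem_support_iff.2 hc)
    rw [indE_apply] at hi
    split_ifs at hi <;> omega
  · intro h m hm
    by_contra! hc
    have h1 : m = indE q (Finset.univ.filter fun i => m i = 1) := by
      ext i
      rw [indE_apply]
      have := hc i
      simp only [Finset.mem_filter, Finset.mem_univ, true_and]
      split_ifs <;> omega
    have h2 := congrFun h (Finset.univ.filter fun i => m i = 1)
    change p.coeff (indE q _) = 0 at h2
    rw [← h1] at h2
    exact (MvPolynomial.mem_support_iff.1 hm) h2

lemma sqfCoeff_surj (q : ℕ) : Function.Surjective (sqfCoeff q) := by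
  intro a
  refine ⟨∑ A, MvPolynomial.monomial (indE q A) (a A), ?_⟩
  ext B
  change MvPolynomial.coeff (indE q B) _ = _
  rw [MvPolynomial.coeff_sum]
  simp [MvPolynomial.coeff_monomial, (indE_inj q).eq_iff]

lemma card_Rq (q : ℕ) : Nat.card (Rq q) = 2 ^ 2 ^ q := by
  have h : Nat.card (Rq q) = Nat.card (Finset (Fin q) → ZMod 2) := by
    have hw : ∀ x y : MvPolynomial (Fin q) (ZMod 2),
        Ideal.Quotient.mk (sqIdeal q) x = Ideal.Quotient.mk (sqIdeal q) y ↔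
          sqfCoeff q x = sqfCoeff q y := by
      intro x y
      rw [Ideal.Quotient.eq, mem_iff_coeff, map_sub, sub_eq_zero]
    choose s hs using Ideal.Quotient.mk_surjective (I := sqIdeal q)
    refine Nat.card_congr (Equiv.ofBijective (fun r => sqfCoeff q (s r)) ⟨?_, ?_⟩)
    · intro x y h
      have := (hw _ _).2 h
      rwa [hs, hs] at this
    · intro a
      obtain ⟨p, hp⟩ := sqfCoeff_surj q a
      refine ⟨Ideal.Quotient.mk _ p, ?_⟩
      rw [← hp]
      exact (hw _ _).1 (hs _)
  rw [h, Nat.card_fun]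
  simp

lemma uTop_ne (q : ℕ) : uTop q ≠ 0 := by
  rw [uTop, uA, ← map_prod, Ne, Ideal.Quotient.eq_zero_iff_mem, mem_iff_coeff]
  intro h
  have h2 := congrFun h Finset.univ
  change MvPolynomial.coeff (indE q _) _ = 0 at h2
  have : (∏ i : Fin q, (MvPolynomial.X i : MvPolynomial (Fin q) (ZMod 2)))
      = MvPolynomial.monomial (indE q Finset.univ) 1 := by
    rw [MvPolynomial.monomial_eq, Finsupp.prod_fintype _ _ (by simp)]
    simp [indE_apply]
  rw [this] at h2
  simp at h2

/-- augmentation -/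
noncomputable def aug (q : ℕ) : Rq q →+* ZMod 2 :=
  Ideal.Quotient.lift (sqIdeal q) MvPolynomial.constantCoeff (by
    intro p hp
    have h := congrFun ((mem_iff_coeff q p).1 hp) ∅
    change MvPolynomial.coeff (indE q ∅) p = 0 at h
    have h0 : indE q ∅ = 0 := by ext; simp [indE_apply]
    rwa [h0] at h)

lemma uTop_mul_X (q : ℕ) (i : Fin q) :
    uTop q * Ideal.Quotient.mk (sqIdeal q) (MvPolynomial.X i) = 0 := by
  rw [uTop, uA, ← Finset.mul_prod_erase _ _ (Finset.mem_univ i), mul_right_comm, ← map_mul,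
    ← pow_two]
  have h : (MvPolynomial.X i ^ 2 : MvPolynomial (Fin q) (ZMod 2)) ∈ sqIdeal q :=
    Ideal.subset_span ⟨i, rfl⟩
  rw [Ideal.Quotient.eq_zero_iff_mem.2 h, zero_mul]

lemma uTop_mul (q : ℕ) (x : Rq q) :
    uTop q * x = uTop q * algebraMap (ZMod 2) (Rq q) (aug q x) := by
  obtain ⟨p, rfl⟩ := Ideal.Quotient.mk_surjective x
  induction p using MvPolynomial.induction_on with
  | C a =>
    have h : aug q (Ideal.Quotient.mk (sqIdeal q) (MvPolynomial.C a)) = a := by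
      simp [aug]
    rw [h]
    rfl
  | add p r hp hr => rw [map_add, map_add, map_add, mul_add, mul_add, hp, hr]
  | mul_X p i hp =>
    have h : aug q (Ideal.Quotient.mk (sqIdeal q) (MvPolynomial.X i)) = 0 := by
      simp [aug]
    rw [map_mul, map_mul, h, mul_left_comm, uTop_mul_X]
    simp

lemma uTop_inj (q : ℕ) (a b : ZMod 2)
    (h : uTop q * algebraMap (ZMod 2) (Rq q) a = uTop q * algebraMap (ZMod 2) (Rq q) b) :
    a = b := by
  have h0 := uTop_ne q
  rcases zmod2_cases a with rfl | rfl <;> rcases zmod2_cases b with rfl | rfl <;> simp_all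

/-- functional -/
noncomputable def fn (q k : ℕ) (a : Fin k → ZMod 2) : (Fin k → Rq q) →+ ZMod 2 where
  toFun v := ∑ i, a i * aug q (v i)
  map_zero' := by simp
  map_add' := by intros; simp [mul_add, Finset.sum_add_distrib]

lemma fn_apply (q k : ℕ) (a : Fin k → ZMod 2) (v) : fn q k a v = ∑ i, a i * aug q (v i) := rfl

lemma fn_single (q k : ℕ) (a : Fin k → ZMod 2) (j : Fin k) : fn q k a (Pi.single j 1) = a j := by
  rw [fn_apply, Finset.sum_eq_single j]
  · simp
  · intro b _ hb
    simp [hb]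
  · simp

/-- excluded vectors -/
def excl (q k u : ℕ) : AddSubgroup (Fin k → Rq q) where
  carrier := {v | ∀ i : Fin k, ¬ ¬ (i : ℕ) < k - u → v i = 0}
  zero_mem' := by intro i _; rfl
  add_mem' := by
    intro a b ha hb i hi
    simp [ha i hi, hb i hi]
  neg_mem' := by
    intro a ha i hi
    simp [ha i hi]

lemma finite_Rq (q : ℕ) : Finite (Rq q) :=
  Nat.finite_of_card_ne_zero (by rw [card_Rq]; positivity)

lemma mem_excl {q k u : ℕ} (v : Fin k → Rq q) :
    v ∈ excl q k u ↔ ¬ ∃ i : Fin k, (i : ℕ) < k - u ∧ v i ≠ 0 := by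
  change (∀ i : Fin k, ¬ ¬ (i : ℕ) < k - u → v i = 0) ↔ _
  push Not
  rfl

lemma card_excl (q k u : ℕ) (huk : u ≤ k) : Nat.card (excl q k u) = 2 ^ (2 ^ q * u) := by
  have h := card_supported (ι := Fin k) (M := Rq q) (fun i => ¬ (i : ℕ) < k - u)
  have h2 := card_compl_add (fun i : Fin k => (i : ℕ) < k - u)
  rw [card_lt_sub, Nat.card_fin] at h2
  rw [show Nat.card {i : Fin k // ¬ (i : ℕ) < k - u} = u by omega, card_Rq, ← pow_mul] at h
  exact h

lemma card_all (q k : ℕ) : Nat.card (Fin k → Rq q) = 2 ^ (2 ^ q * k) := by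
  rw [Nat.card_fun, card_Rq, Nat.card_fin, ← pow_mul]

lemma card_MacIdx (q k u : ℕ) (huk : u ≤ k) :
    Nat.card (MacIdx q k u) = 2 ^ (2 ^ q * k) - 2 ^ (2 ^ q * u) := by
  have := finite_Rq q
  have h := card_compl_add (fun v : Fin k → Rq q => v ∈ excl q k u)
  rw [card_all] at h
  have h1 : Nat.card {v // v ∈ excl q k u} = _ := card_excl q k u huk
  have h2 : Nat.card (MacIdx q k u) = Nat.card {v // ¬ v ∈ excl q k u} := by
    refine Nat.card_congr (Equiv.subtypeEquivRight fun v => ?_)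
    rw [mem_excl, not_not]
  omega

/-- codeword -/
noncomputable def cw (q k u : ℕ) (a : Fin k → ZMod 2) : MacIdx q k u → ZMod 2 :=
  fun v => fn q k a v.1

lemma wt_split (q k u : ℕ) (a : Fin k → ZMod 2) :
    hWt (cw q k u a) + Nat.card {v : excl q k u // fn q k a v.1 ≠ 0} =
      Nat.card {v : Fin k → Rq q // fn q k a v ≠ 0} := by
  have := finite_Rq q
  rw [← card_compl_add (fun v : {v : Fin k → Rq q // fn q k a v ≠ 0} => v.1 ∈ excl q k u), add_comm]
  congr 1
  · exact Nat.card_congr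
      { toFun := fun v => ⟨⟨v.1.1, v.2⟩, v.1.2⟩
        invFun := fun v => ⟨⟨v.1.1, v.2⟩, v.1.2⟩
        left_inv := fun v => rfl
        right_inv := fun v => rfl }
  · exact Nat.card_congr
      { toFun := fun v => ⟨⟨v.1.1, v.2⟩, by
          have := v.1.2
          rw [mem_excl, not_not]; exact this⟩
        invFun := fun v => ⟨⟨v.1.1, by
          have := v.2
          rwa [mem_excl, not_not] at this⟩, v.1.2⟩
        left_inv := fun v => rfl
        right_inv := fun v => rfl }

lemma two_mul_half (n : ℕ) (hn : 0 < n) : 2 * 2 ^ (n - 1) = 2 ^ n := by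
  rw [← pow_succ', Nat.sub_add_cancel hn]

lemma card_half_all (q k : ℕ) (a : Fin k → ZMod 2) (ha : a ≠ 0) :
    Nat.card {v : Fin k → Rq q // fn q k a v ≠ 0} = 2 ^ (2 ^ q * k - 1) := by
  have := finite_Rq q
  obtain ⟨j, hj⟩ := Function.ne_iff.1 ha
  have h := card_half (fn q k a) (Pi.single j 1) (by
    rw [fn_single]; exact (zmod2_cases _).resolve_left hj)
  rw [card_all, ← two_mul_half _ (Nat.mul_pos (by positivity) (by have := j.2; omega))] at h
  omega

lemma wt_zero (q k u : ℕ) : hWt (cw q k u 0) = 0 := by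
  have h := wt_split q k u 0
  have : Nat.card {v : Fin k → Rq q // fn q k 0 v ≠ 0} = 0 := by
    have : IsEmpty {v : Fin k → Rq q // fn q k 0 v ≠ 0} := ⟨fun v => v.2 (by simp [fn_apply])⟩
    simp
  omega

lemma wt_big (q k u : ℕ) (a : Fin k → ZMod 2) (ha : a ≠ 0)
    (h0 : ∀ i : Fin k, ¬ (i : ℕ) < k - u → a i = 0) :
    hWt (cw q k u a) = 2 ^ (2 ^ q * k - 1) := by
  have h := wt_split q k u a
  rw [card_half_all q k a ha] at h
  have : Nat.card {v : excl q k u // fn q k a v.1 ≠ 0} = 0 := by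
    have : IsEmpty {v : excl q k u // fn q k a v.1 ≠ 0} := ⟨fun v => v.2 (by
      rw [fn_apply]
      refine Finset.sum_eq_zero fun i _ => ?_
      by_cases hi : (i : ℕ) < k - u
      · rw [v.1.2 i (not_not.2 hi)]; simp
      · rw [h0 i hi]; simp)⟩
    simp
  omega

lemma wt_small (q k u : ℕ) (hu : 1 ≤ u) (huk : u ≤ k) (a : Fin k → ZMod 2)
    (h0 : ¬ ∀ i : Fin k, ¬ (i : ℕ) < k - u → a i = 0) :
    hWt (cw q k u a) = 2 ^ (2 ^ q * k - 1) - 2 ^ (2 ^ q * u - 1) := by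
  have := finite_Rq q
  have ha : a ≠ 0 := by
    rintro rfl
    exact h0 fun i _ => rfl
  have h := wt_split q k u a
  rw [card_half_all q k a ha] at h
  push Not at h0
  obtain ⟨j, hj, hja⟩ := h0
  have h2 := card_half ((fn q k a).comp (excl q k u).subtype) ⟨Pi.single j 1, by
      intro i hi
      have : i ≠ j := by rintro rfl; omega
      simp [this]⟩ (by
    change fn q k a (Pi.single j 1) = 1
    rw [fn_single]; exact (zmod2_cases _).resolve_left hja)
  rw [card_excl _ _ _ huk, ← two_mul_half _ (Nat.mul_pos (by positivity) (by omega))] at h2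
  change 2 * Nat.card {v : excl q k u // fn q k a v.1 ≠ 0} = _ at h2
  omega

lemma pow_gap (q k u : ℕ) (hu : 1 ≤ u) (huk : u < k) :
    2 ^ (2 ^ q * u - 1) < 2 ^ (2 ^ q * k - 1) := by
  apply Nat.pow_lt_pow_right (by norm_num)
  have h1 : 0 < 2 ^ q := by positivity
  have h2 : 2 ^ q * u < 2 ^ q * k := Nat.mul_lt_mul_of_pos_left huk h1
  have h3 : 0 < 2 ^ q * u := Nat.mul_pos h1 hu
  omega

lemma cw_eq_zero (q k u : ℕ) (hu : 1 ≤ u) (huk : u < k) (a : Fin k → ZMod 2)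
    (h : hWt (cw q k u a) = 0) : a = 0 := by
  by_contra ha
  have := pow_gap q k u hu huk
  by_cases h0 : ∀ i : Fin k, ¬ (i : ℕ) < k - u → a i = 0
  · rw [wt_big q k u a ha h0] at h
    exact absurd h (by positivity)
  · rw [wt_small q k u hu huk.le a h0] at h
    omega

/-- linear encoding -/
noncomputable def enc (q k u : ℕ) : (Fin k → ZMod 2) →ₗ[ZMod 2] (MacIdx q k u → ZMod 2) where
  toFun := cw q k u
  map_add' := by
    intro a b; ext v
    simp [cw, fn_apply, add_mul, Finset.sum_add_distrib]
  map_smul' := by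
    intro a b; ext v
    simp [cw, fn_apply, Finset.mul_sum, mul_assoc]

lemma hWt_zero {ι : Type} : hWt (0 : ι → ZMod 2) = 0 := by
  have : IsEmpty {v : ι // (0 : ι → ZMod 2) v ≠ 0} := ⟨fun v => v.2 rfl⟩
  simp [hWt]

lemma enc_inj (q k u : ℕ) (hu : 1 ≤ u) (huk : u < k) : Function.Injective (enc q k u) := by
  rw [injective_iff_map_eq_zero]
  intro a ha
  apply cw_eq_zero q k u hu huk
  change cw q k u a = 0 at ha
  rw [ha, hWt_zero]

lemma range_enc (q k u : ℕ) (huk : u < k) :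
    Set.range (enc q k u) = macTorsion q k u := by
  ext c
  constructor
  · rintro ⟨a, rfl⟩
    refine ⟨fun i => uTop q * algebraMap (ZMod 2) (Rq q) (a i), fun v => ?_⟩
    change uTop q * algebraMap (ZMod 2) (Rq q) (fn q k a v.1) = _
    rw [fn_apply, map_sum, Finset.mul_sum]
    refine Finset.sum_congr rfl fun i _ => ?_
    rw [map_mul, mul_right_comm, uTop_mul q (v.1 i)]
    ring
  · rintro ⟨m, hm⟩
    have hne : (1 : Rq q) ≠ 0 := by
      intro h
      exact uTop_ne q (by rw [← mul_one (uTop q), h, mul_zero])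
    have key : ∀ i, ∃ a : ZMod 2, m i = uTop q * algebraMap (ZMod 2) (Rq q) a := by
      let z : Fin k := ⟨0, by omega⟩
      have hz := hm ⟨Pi.single z 1, z, by change 0 < k - u; omega, by simpa using hne⟩
      have hs : ∀ i, ∑ j, m j * (Pi.single i 1 : Fin k → Rq q) j = m i := by
        intro i
        simp [Pi.single_apply]
      rw [hs] at hz
      intro i
      by_cases hi : i = z
      · rw [hi]; exact ⟨_, hz.symm⟩
      · have h2 := hm ⟨Pi.single z 1 + Pi.single i 1, z, by change 0 < k - u; omega, by
          simpa [Ne.symm hi] using hne⟩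
        simp only [Pi.add_apply, mul_add, Finset.sum_add_distrib] at h2
        rw [hs, hs, ← hz] at h2
        refine ⟨c ⟨Pi.single z 1 + Pi.single i 1, z, by change 0 < k - u; omega, by
            simpa [Ne.symm hi] using hne⟩ -
            c ⟨Pi.single z 1, z, by change 0 < k - u; omega, by simpa using hne⟩, ?_⟩
        · rw [map_sub, mul_sub, h2]; ring
    choose a ha using key
    refine ⟨a, ?_⟩
    ext v
    apply uTop_inj q
    rw [hm v]
    change uTop q * algebraMap (ZMod 2) (Rq q) (fn q k a v.1) = _
    rw [fn_apply, map_sum, Finset.mul_sum]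
    refine Finset.sum_congr rfl fun i _ => ?_
    rw [ha, map_mul, mul_right_comm, uTop_mul q (v.1 i)]
    ring

/-- encoding as an equivalence -/
noncomputable def encE (q k u : ℕ) (hu : 1 ≤ u) (huk : u < k) :
    (Fin k → ZMod 2) ≃ macTorsion q k u :=
  (Equiv.ofInjective _ (enc_inj q k u hu huk)).trans (Equiv.setCongr (range_enc q k u huk))

lemma card_wt (q k u : ℕ) (hu : 1 ≤ u) (huk : u < k) (w : ℕ) :
    Nat.card {c : ↥(macTorsion q k u) // hWt c.1 = w} =
      Nat.card {a : Fin k → ZMod 2 // hWt (cw q k u a) = w} :=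
  (Nat.card_congr ((encE q k u hu huk).subtypeEquiv fun _ => Iff.rfl)).symm

lemma card_low (k u : ℕ) :
    Nat.card {a : Fin k → ZMod 2 // ∀ i : Fin k, ¬ (i : ℕ) < k - u → a i = 0} = 2 ^ (k - u) := by
  rw [card_supported, card_lt_sub]
  simp

/-- For `1 ≤ u ≤ k−1`, the torsion code `Tor(M^α_(q,k,u))` of the MacDonald code
of type α is a binary linear code of length `2^(2^q·k) − 2^(2^q·u)` with exactly `2^k`
codewords, whose Hamming weight distribution is: one codeword of weight `0`; exactly
`2^k − 2^(k−u)` codewords of weight `2^(2^q·k − 1) − 2^(2^q·u − 1)`; and exactly `2^(k−u) − 1`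
codewords of weight `2^(2^q·k − 1)`.  In particular its minimum Hamming distance is
`2^(2^q·k − 1) − 2^(2^q·u − 1)`. -/
theorem macdonald_alpha_torsion (q k u : ℕ) (hq : 1 ≤ q) (hu : 1 ≤ u) (huk : u ≤ k - 1)
    [Fintype (Rq q)] :
    Nat.card (MacIdx q k u) = 2 ^ (2 ^ q * k) - 2 ^ (2 ^ q * u) ∧
    (∃ D : Submodule (ZMod 2) (MacIdx q k u → ZMod 2),
      (D : Set (MacIdx q k u → ZMod 2)) = macTorsion q k u) ∧
    Nat.card (macTorsion q k u) = 2 ^ k ∧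
    Nat.card {c : ↥(macTorsion q k u) // hWt c.1 = 0} = 1 ∧
    Nat.card {c : ↥(macTorsion q k u) //
        hWt c.1 = 2 ^ (2 ^ q * k - 1) - 2 ^ (2 ^ q * u - 1)} = 2 ^ k - 2 ^ (k - u) ∧
    Nat.card {c : ↥(macTorsion q k u) // hWt c.1 = 2 ^ (2 ^ q * k - 1)} = 2 ^ (k - u) - 1 ∧
    IsLeast {w : ℕ | ∃ c ∈ macTorsion q k u, c ≠ 0 ∧ w = hWt c}
      (2 ^ (2 ^ q * k - 1) - 2 ^ (2 ^ q * u - 1)) := by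

  have hk : u < k := by omega
  have gap := pow_gap q k u hu hk
  have hpos : 0 < 2 ^ (2 ^ q * u - 1) := by positivity
  have hall : Nat.card (Fin k → ZMod 2) = 2 ^ k := by simp
  have hlow := card_low k u
  have hz : Nat.card {a : Fin k → ZMod 2 // a = 0} = 1 := by simp
  refine ⟨card_MacIdx q k u hk.le, ⟨LinearMap.range (enc q k u), ?_⟩, ?_, ?_, ?_, ?_, ?_, ?_⟩
  · rw [LinearMap.coe_range, range_enc q k u hk]
  · rw [← hall]
    exact (Nat.card_congr (encE q k u hu hk)).symm
  · rw [card_wt q k u hu hk, ← hz]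
    refine Nat.card_congr (Equiv.subtypeEquivRight fun a => ⟨cw_eq_zero q k u hu hk a, ?_⟩)
    rintro rfl
    exact wt_zero q k u
  · rw [card_wt q k u hu hk]
    have h := card_compl_add
      (fun a : Fin k → ZMod 2 => ∀ i : Fin k, ¬ (i : ℕ) < k - u → a i = 0)
    rw [hall, hlow] at h
    have h2 : Nat.card {a : Fin k → ZMod 2 //
        hWt (cw q k u a) = 2 ^ (2 ^ q * k - 1) - 2 ^ (2 ^ q * u - 1)} =
        Nat.card {a : Fin k → ZMod 2 // ¬ ∀ i : Fin k, ¬ (i : ℕ) < k - u → a i = 0} := by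
      refine Nat.card_congr (Equiv.subtypeEquivRight fun a =>
        ⟨fun hw h0 => ?_, wt_small q k u hu hk.le a⟩)
      by_cases ha : a = 0
      · rw [ha, wt_zero] at hw
        omega
      · rw [wt_big q k u a ha h0] at hw
        omega
    omega
  · rw [card_wt q k u hu hk]
    have h := card_compl_add
      (fun a : {a : Fin k → ZMod 2 // ∀ i : Fin k, ¬ (i : ℕ) < k - u → a i = 0} => a.1 = 0)
    rw [hlow] at h
    have h1 : Nat.card {a : {a : Fin k → ZMod 2 // ∀ i : Fin k, ¬ (i : ℕ) < k - u → a i = 0} //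
        a.1 = 0} = 1 := by
      rw [← hz]
      exact Nat.card_congr
        { toFun := fun a => ⟨a.1.1, a.2⟩
          invFun := fun a => ⟨⟨a.1, fun i _ => by rw [a.2]; rfl⟩, a.2⟩
          left_inv := fun a => rfl
          right_inv := fun a => rfl }
    have hiff : ∀ a : Fin k → ZMod 2, hWt (cw q k u a) = 2 ^ (2 ^ q * k - 1) →
        (∀ i : Fin k, ¬ (i : ℕ) < k - u → a i = 0) ∧ a ≠ 0 := by
      intro a hw
      constructor
      · by_contra h0
        rw [wt_small q k u hu hk.le a h0] at hw
        omega
      · rintro rfl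
        rw [wt_zero] at hw
        omega
    have h2 : Nat.card {a : Fin k → ZMod 2 // hWt (cw q k u a) = 2 ^ (2 ^ q * k - 1)} =
        Nat.card {a : {a : Fin k → ZMod 2 // ∀ i : Fin k, ¬ (i : ℕ) < k - u → a i = 0} //
          ¬ a.1 = 0} :=
      Nat.card_congr
        { toFun := fun a => ⟨⟨a.1, (hiff a.1 a.2).1⟩, (hiff a.1 a.2).2⟩
          invFun := fun a => ⟨a.1.1, wt_big q k u a.1.1 a.2 a.1.2⟩
          left_inv := fun a => rfl
          right_inv := fun a => rfl }
    omega
  · let z : Fin k := ⟨k - 1, by omega⟩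
    have hw := wt_small q k u hu hk.le (Pi.single z 1) (by
      intro h
      have := h z (by change ¬ (k - 1 < k - u); omega)
      simp at this)
    refine ⟨cw q k u (Pi.single z 1), ?_, ?_, hw.symm⟩
    · rw [← range_enc q k u hk]
      exact ⟨_, rfl⟩
    · intro h
      rw [h, hWt_zero] at hw
      omega
  · rintro w ⟨c, hc, hne, rfl⟩
    rw [← range_enc q k u hk] at hc
    obtain ⟨a, rfl⟩ := hc
    have ha : a ≠ 0 := by
      rintro rfl
      exact hne (map_zero _)
    change _ ≤ hWt (cw q k u a)
    by_cases h0 : ∀ i : Fin k, ¬ (i : ℕ) < k - u → a i = 0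
    · rw [wt_big q k u a ha h0]
      omega
    · rw [wt_small q k u hu hk.le a h0]
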